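/- Shifted MacMahon's formula: ∑_{π ∈ SP} 2^{k(π)} s^{|π|} = ∏_{n=1}^{∞} [ (1 + s^n) / (1 - s^n) ]^n, where the sum is over all strict plane partitions, as an identity of formal power series in s (equivalently, for real 0 ≤ s < 1). -/

import Mathlib

open scoped BigOperators

/-- A plane partition: a filling of a Young diagram (its support) with positive
integers that are weakly decreasing along rows and columns.  Entries outside
the support are recorded as `0`, and rows and columns are indexed from `0`
(so box `(i, j)` is box `(i+1, j+1)` in the 1-indexed convention). -/
structure PlanePartition where
  part : ℕ → ℕ → ℕ
  row_decr : ∀ i j, part i (j + 1) ≤ part i j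
  col_decr : ∀ i j, part (i + 1) j ≤ part i j
  finite_supp : {p : ℕ × ℕ | part p.1 p.2 ≠ 0}.Finite

namespace PlanePartition

/-- The weight `|π|`: the sum of all entries of `π`. -/
noncomputable def weight (π : PlanePartition) : ℕ := ∑ᶠ p : ℕ × ℕ, π.part p.1 p.2

/-- The trace `tr(π)`: the sum of the diagonal entries of `π`. -/
noncomputable def trace (π : PlanePartition) : ℕ := ∑ᶠ i : ℕ, π.part i i

/-- A strict plane partition: all of the diagonal partitions of `π` have
distinct parts, i.e. every diagonal of `π` is strictly decreasing where
nonzero. -/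
def IsStrict (π : PlanePartition) : Prop :=
  ∀ i j, π.part i j ≠ 0 → π.part (i + 1) (j + 1) < π.part i j

end PlanePartition

/-- Two boxes of `ℕ × ℕ` are adjacent when they share an edge. -/
def Adjacent (p q : ℕ × ℕ) : Prop :=
  (p.1 = q.1 ∧ (p.2 + 1 = q.2 ∨ q.2 + 1 = p.2)) ∨
  (p.2 = q.2 ∧ (p.1 + 1 = q.1 ∨ q.1 + 1 = p.1))

/-- One step of connectivity for a filling `g` of boxes by natural numbers:
adjacent boxes carrying the same nonzero entry. -/
def ConnStep (g : ℕ → ℕ → ℕ) (p q : ℕ × ℕ) : Prop :=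
  Adjacent p q ∧ g p.1 p.2 = g q.1 q.2 ∧ g p.1 p.2 ≠ 0

/-- `p` and `q` belong to the same connected component of `g`: both are boxes
of the support and they are joined by a chain of adjacent boxes all filled
with the same number. -/
def SameComponent (g : ℕ → ℕ → ℕ) (p q : ℕ × ℕ) : Prop :=
  g p.1 p.2 ≠ 0 ∧ Relation.ReflTransGen (ConnStep g) p q

/-- The set of connected components of a filling `g`. -/
def components (g : ℕ → ℕ → ℕ) : Set (Set (ℕ × ℕ)) :=
  {C | ∃ p : ℕ × ℕ, g p.1 p.2 ≠ 0 ∧ C = {q | SameComponent g p q}}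

/-- `k(g)`: the number of connected components. -/
noncomputable def numComponents (g : ℕ → ℕ → ℕ) : ℕ := (components g).ncard

/-- The level `h(p)` of a box `p`: the smallest positive `h` such that the box
shifted diagonally by `h` does not belong to the same connected component. -/
noncomputable def level (g : ℕ → ℕ → ℕ) (p : ℕ × ℕ) : ℕ :=
  sInf {h : ℕ | 0 < h ∧ ¬ SameComponent g p (p.1 + h, p.2 + h)}

/-- One step of border connectivity: adjacent boxes with the same nonzero
entry and the same level. -/
def BorderStep (g : ℕ → ℕ → ℕ) (p q : ℕ × ℕ) : Prop :=
  ConnStep g p q ∧ level g p = level g q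

/-- `p` and `q` belong to the same border component. -/
def SameBorder (g : ℕ → ℕ → ℕ) (p q : ℕ × ℕ) : Prop :=
  g p.1 p.2 ≠ 0 ∧ Relation.ReflTransGen (BorderStep g) p q

/-- The set of border components of a filling `g` (each border component is a
maximal connected set of boxes with the same entry and the same level). -/
def borderComponents (g : ℕ → ℕ → ℕ) : Set (Set (ℕ × ℕ)) :=
  {B | ∃ p : ℕ × ℕ, g p.1 p.2 ≠ 0 ∧ B = {q | SameBorder g p q}}

/-- The (common) level of the boxes of a border component `B`. -/
noncomputable def borderLevel (g : ℕ → ℕ → ℕ) (B : Set (ℕ × ℕ)) : ℕ :=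
  sInf {h : ℕ | ∃ p ∈ B, level g p = h}

/-- The polynomial `A_π(t)`: the product over all border components `B` of
`π` of `(1 - t ^ level(B))`; equivalently the product over connected
components `C` of `P_C(t) = ∏_i (1 - t^i)^{n_i}` where `n_i` is the number of
`i`-level border components of `C`. -/
noncomputable def Apoly (t : ℝ) (π : PlanePartition) : ℝ :=
  ∏ᶠ B ∈ borderComponents π.part, (1 - t ^ borderLevel π.part B)

/-- The function `f(n, m)` (for parameters `q`, `t`); the empty product gives
`f(0, m) = 1`. -/
noncomputable def fmac (q t : ℝ) (n m : ℕ) : ℝ :=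
  ∏ i ∈ Finset.range n, (1 - q ^ i * t ^ (m + 1)) / (1 - q ^ (i + 1) * t ^ m)

/-- `F_π(i,j)(q,t)`, associated to the box `(i, j)` of `π`: with
`λ = (π(i,j), π(i+1,j+1), …)`, `μ = (π(i+1,j), π(i+2,j+1), …)` and
`ν = (π(i,j+1), π(i+1,j+2), …)`, this is
`∏_{m ≥ 0} f(λ₁-μ_{m+1},m) f(λ₁-ν_{m+1},m) / (f(λ₁-λ_{m+1},m) f(λ₁-λ_{m+2},m))`
(only finitely many factors differ from `1`). -/
noncomputable def Fbox (q t : ℝ) (π : PlanePartition) (i j : ℕ) : ℝ :=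
  ∏' m : ℕ,
    (fmac q t (π.part i j - π.part (i + 1 + m) (j + m)) m *
        fmac q t (π.part i j - π.part (i + m) (j + 1 + m)) m) /
      (fmac q t (π.part i j - π.part (i + m) (j + m)) m *
        fmac q t (π.part i j - π.part (i + m + 1) (j + m + 1)) m)

/-- `F_π(q,t)`: the product of `F_π(i,j)(q,t)` over all boxes `(i,j)` of the
support of `π`. -/
noncomputable def Fmac (q t : ℝ) (π : PlanePartition) : ℝ :=
  ∏ᶠ p : ℕ × ℕ, if π.part p.1 p.2 ≠ 0 then Fbox q t π p.1 p.2 else 1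

/-- The infinite `q`-Pochhammer symbol `(x; q)_∞ = ∏_{n ≥ 0} (1 - x qⁿ)`. -/
noncomputable def qPoch (x q : ℝ) : ℝ := ∏' n : ℕ, (1 - x * q ^ n)

open Finset
open scoped ENNReal

/-! ### Strict partitions as finite sets

A strict partition is encoded by the finset `S` of all `j` such that `j + 1` is a part. -/

/-- The number of parts exceeding `v`. -/
def partCount (S : Finset ℕ) (v : ℕ) : ℕ := #{j ∈ S | v ≤ j}

/-- The sum of the parts. -/
def partSum (S : Finset ℕ) : ℕ := ∑ j ∈ S, (j + 1)

/-- The strict partitions `S` and `T` interlace: `S₁ ≥ T₁ ≥ S₂ ≥ T₂ ≥ ⋯`. -/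
def Interlace (S T : Finset ℕ) : Prop :=
  ∀ v, partCount T v ≤ partCount S v ∧ partCount S v ≤ partCount T v + 1

/-- Increase all parts by one, then add a part `1` if `b` is true. -/
def bitCons (b : Bool) (S : Finset ℕ) : Finset ℕ :=
  (if b then {0} else ∅) ∪ S.map ⟨Nat.succ, Nat.succ_injective⟩

@[simp] lemma zero_mem_bitCons {b : Bool} {S : Finset ℕ} : 0 ∈ bitCons b S ↔ b = true := by
  cases b <;> simp [bitCons]

@[simp] lemma succ_mem_bitCons {b : Bool} {S : Finset ℕ} {j : ℕ} :
    j + 1 ∈ bitCons b S ↔ j ∈ S := by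
  cases b <;> simp [bitCons]

/-- `bitCons` as an equivalence. -/
noncomputable def bitConsEquiv : Bool × Finset ℕ ≃ Finset ℕ where
  toFun p := bitCons p.1 p.2
  invFun S := (decide (0 ∈ S), S.preimage Nat.succ Nat.succ_injective.injOn)
  left_inv p := by
    ext <;> simp
  right_inv S := by
    ext j
    cases j <;> simp

lemma sum_bitCons {M : Type*} [AddCommMonoid M] (b : Bool) (S : Finset ℕ) (f : ℕ → M) :
    ∑ j ∈ bitCons b S, f j = (if b then f 0 else 0) + ∑ j ∈ S, f (j + 1) := by
  rw [bitCons, sum_union (by cases b <;> simp), sum_map]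
  cases b <;> simp

lemma card_bitCons (b : Bool) (S : Finset ℕ) : #(bitCons b S) = b.toNat + #S := by
  rw [card_eq_sum_ones, sum_bitCons]
  cases b <;> simp

lemma partSum_bitCons (b : Bool) (S : Finset ℕ) :
    partSum (bitCons b S) = partSum S + #(bitCons b S) := by
  rw [card_bitCons, partSum, sum_bitCons, partSum, sum_add_distrib (f := fun j => j + 1)]
  cases b
  · simp
  · simp; omega

lemma bitCons_sdiff (b c : Bool) (S T : Finset ℕ) :
    bitCons b S \ bitCons c T = bitCons (b && !c) (S \ T) := by
  ext j
  cases j <;> simp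

lemma partCount_zero (S : Finset ℕ) : partCount S 0 = #S := by simp [partCount]

lemma partCount_bitCons_succ (b : Bool) (S : Finset ℕ) (v : ℕ) :
    partCount (bitCons b S) (v + 1) = partCount S v := by
  simp only [partCount, card_filter, sum_bitCons]
  simp

lemma interlace_bitCons {b c : Bool} {S T : Finset ℕ} :
    Interlace (bitCons b S) (bitCons c T) ↔
      Interlace S T ∧ #(bitCons c T) ≤ #(bitCons b S) ∧ #(bitCons b S) ≤ #(bitCons c T) + 1 := by
  constructor
  · intro h
    refine ⟨fun v => ?_, ?_⟩
    · simpa [partCount_bitCons_succ] using h (v + 1)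
    · simpa [partCount_zero] using h 0
  · rintro ⟨h, h0⟩ (_ | v)
    · simpa [partCount_zero] using h0
    · simpa [partCount_bitCons_succ] using h v

lemma Interlace.card_le {S T : Finset ℕ} (h : Interlace S T) : #T ≤ #S ∧ #S ≤ #T + 1 := by
  simpa [partCount_zero] using h 0

/-- Induction on pairs of strict partitions by removing the smallest part. -/
lemma bitCons_induction₂ {P : Finset ℕ → Finset ℕ → Prop} (empty : P ∅ ∅)
    (cons : ∀ b c S T, P S T → P (bitCons b S) (bitCons c T)) (S T : Finset ℕ) : P S T := by
  obtain ⟨N, hS, hT⟩ : ∃ N, S ⊆ range N ∧ T ⊆ range N := by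
    obtain ⟨N, hN⟩ := (S ∪ T).exists_nat_subset_range
    exact ⟨N, subset_union_left.trans hN, subset_union_right.trans hN⟩
  induction N generalizing S T with
  | zero =>
    simp only [range_zero, subset_empty] at hS hT
    exact hS ▸ hT ▸ empty
  | succ N ih =>
    obtain ⟨⟨b, S'⟩, rfl⟩ := bitConsEquiv.surjective S
    obtain ⟨⟨c, T'⟩, rfl⟩ := bitConsEquiv.surjective T
    refine cons b c S' T' (ih S' T' ?_ ?_)
    · intro j hj
      have := hS (show j + 1 ∈ bitCons b S' by simpa)
      simpa using this
    · intro j hj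
      have := hT (show j + 1 ∈ bitCons c T' by simpa)
      simpa using this

lemma Interlace.partSum_le {S T : Finset ℕ} : Interlace S T → partSum T ≤ partSum S := by
  induction S, T using bitCons_induction₂ with
  | empty => simp
  | cons b c S T ih =>
    rw [interlace_bitCons, partSum_bitCons, partSum_bitCons]
    rintro ⟨h, h1, -⟩
    exact add_le_add (ih h) h1

lemma tsum_bitCons (f : Finset ℕ → ℝ≥0∞) :
    ∑' S, f S = ∑' S, f (bitCons false S) + ∑' S, f (bitCons true S) := by
  rw [← bitConsEquiv.tsum_eq f]
  change ∑' p : Bool × Finset ℕ, f (bitCons p.1 p.2) = _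
  rw [ENNReal.tsum_prod (f := fun b S => f (bitCons b S)), tsum_fintype, Fintype.sum_bool, add_comm]

/-- The summand of `upperSum`. -/
noncomputable def upperTerm (z : ℝ≥0∞) (μ ν : Finset ℕ) (a b : ℤ) (S : Finset ℕ) : ℝ≥0∞ :=
  open Classical in
  if Interlace S μ ∧ Interlace S ν ∧ (#S : ℤ) = #μ + a ∧ (#S : ℤ) = #ν + b then
    2 ^ #(μ \ S) * 2 ^ #(S \ ν) * z ^ (partSum S - partSum μ) else 0

/-- The summand of `lowerSum`. -/
noncomputable def lowerTerm (z : ℝ≥0∞) (μ ν : Finset ℕ) (a b : ℤ) (S : Finset ℕ) : ℝ≥0∞ :=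
  open Classical in
  if Interlace μ S ∧ Interlace ν S ∧ (#S : ℤ) + a = #μ ∧ (#S : ℤ) + b = #ν then
    2 ^ #(S \ ν) * 2 ^ #(μ \ S) * z ^ (partSum ν - partSum S) else 0

/-- The weighted sum over all strict partitions interlacing `μ` and `ν` from above which have
`a` parts more than `μ` and `b` parts more than `ν`. -/
noncomputable def upperSum (z : ℝ≥0∞) (μ ν : Finset ℕ) (a b : ℤ) : ℝ≥0∞ :=
  ∑' S, upperTerm z μ ν a b S

/-- The weighted sum over all strict partitions interlacing `μ` and `ν` from below which have
`a` parts less than `μ` and `b` parts less than `ν`. -/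
noncomputable def lowerSum (z : ℝ≥0∞) (μ ν : Finset ℕ) (a b : ℤ) : ℝ≥0∞ :=
  ∑' S, lowerTerm z μ ν a b S

lemma upperTerm_bitCons (z : ℝ≥0∞) (m n c : Bool) (μ ν S : Finset ℕ) {a b : ℤ}
    (ha : a = 0 ∨ a = 1) (hb : b = 0 ∨ b = 1) :
    upperTerm z (bitCons m μ) (bitCons n ν) a b (bitCons c S) =
      z ^ a.toNat * 2 ^ ((m && !c).toNat + (c && !n).toNat) *
        upperTerm z μ ν (a + m.toNat - c.toNat) (b + n.toNat - c.toNat) S := by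
  have key : (Interlace (bitCons c S) (bitCons m μ) ∧ Interlace (bitCons c S) (bitCons n ν) ∧
      (#(bitCons c S) : ℤ) = #(bitCons m μ) + a ∧ (#(bitCons c S) : ℤ) = #(bitCons n ν) + b) ↔
      (Interlace S μ ∧ Interlace S ν ∧ (#S : ℤ) = #μ + (a + m.toNat - c.toNat) ∧
        (#S : ℤ) = #ν + (b + n.toNat - c.toNat)) := by
    rw [interlace_bitCons, interlace_bitCons]
    simp only [card_bitCons]
    constructor
    · rintro ⟨⟨h1, -⟩, ⟨h2, -⟩, h3, h4⟩
      refine ⟨h1, h2, ?_, ?_⟩ <;> push_cast at * <;> linarith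
    · rintro ⟨h1, h2, h3, h4⟩
      refine ⟨⟨h1, ?_⟩, ⟨h2, ?_⟩, ?_, ?_⟩ <;> omega
  rw [upperTerm, upperTerm]
  by_cases h : Interlace S μ ∧ Interlace S ν ∧ (#S : ℤ) = #μ + (a + m.toNat - c.toNat) ∧
        (#S : ℤ) = #ν + (b + n.toNat - c.toNat)
  · rw [if_pos (key.2 h), if_pos h, bitCons_sdiff, bitCons_sdiff, card_bitCons, card_bitCons]
    have e : partSum (bitCons c S) - partSum (bitCons m μ) =
        a.toNat + (partSum S - partSum μ) := by
      have := h.1.partSum_le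
      have := (key.2 h).2.2.1
      rw [partSum_bitCons, partSum_bitCons]
      omega
    rw [e]
    ring
  · rw [if_neg (fun h' => h (key.1 h')), if_neg h, mul_zero]

lemma lowerTerm_bitCons (z : ℝ≥0∞) (m n c : Bool) (μ ν S : Finset ℕ) {a b : ℤ}
    (ha : a = 0 ∨ a = 1) (hb : b = 0 ∨ b = 1) :
    lowerTerm z (bitCons m μ) (bitCons n ν) a b (bitCons c S) =
      z ^ b.toNat * 2 ^ ((m && !c).toNat + (c && !n).toNat) *
        lowerTerm z μ ν (a + c.toNat - m.toNat) (b + c.toNat - n.toNat) S := by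
  have key : (Interlace (bitCons m μ) (bitCons c S) ∧ Interlace (bitCons n ν) (bitCons c S) ∧
      (#(bitCons c S) : ℤ) + a = #(bitCons m μ) ∧ (#(bitCons c S) : ℤ) + b = #(bitCons n ν)) ↔
      (Interlace μ S ∧ Interlace ν S ∧ (#S : ℤ) + (a + c.toNat - m.toNat) = #μ ∧
        (#S : ℤ) + (b + c.toNat - n.toNat) = #ν) := by
    rw [interlace_bitCons, interlace_bitCons]
    simp only [card_bitCons]
    constructor
    · rintro ⟨⟨h1, -⟩, ⟨h2, -⟩, h3, h4⟩
      refine ⟨h1, h2, ?_, ?_⟩ <;> push_cast at * <;> linarith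
    · rintro ⟨h1, h2, h3, h4⟩
      refine ⟨⟨h1, ?_⟩, ⟨h2, ?_⟩, ?_, ?_⟩ <;> omega
  rw [lowerTerm, lowerTerm]
  by_cases h : Interlace μ S ∧ Interlace ν S ∧ (#S : ℤ) + (a + c.toNat - m.toNat) = #μ ∧
        (#S : ℤ) + (b + c.toNat - n.toNat) = #ν
  · rw [if_pos (key.2 h), if_pos h, bitCons_sdiff, bitCons_sdiff, card_bitCons, card_bitCons]
    have e : partSum (bitCons n ν) - partSum (bitCons c S) =
        b.toNat + (partSum ν - partSum S) := by
      have := h.2.1.partSum_le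
      have := (key.2 h).2.2.2
      rw [partSum_bitCons, partSum_bitCons]
      omega
    rw [e]
    ring
  · rw [if_neg (fun h' => h (key.1 h')), if_neg h, mul_zero]

lemma upperSum_bitCons (z : ℝ≥0∞) (m n : Bool) (μ ν : Finset ℕ) {a b : ℤ}
    (ha : a = 0 ∨ a = 1) (hb : b = 0 ∨ b = 1) :
    upperSum z (bitCons m μ) (bitCons n ν) a b =
      z ^ a.toNat * 2 ^ m.toNat * upperSum z μ ν (a + m.toNat) (b + n.toNat) +
      z ^ a.toNat * 2 ^ (!n).toNat * upperSum z μ ν (a + m.toNat - 1) (b + n.toNat - 1) := by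
  simp only [upperSum]
  rw [tsum_bitCons]
  simp [upperTerm_bitCons z _ _ _ _ _ _ ha hb, ENNReal.tsum_mul_left]

lemma lowerSum_bitCons (z : ℝ≥0∞) (m n : Bool) (μ ν : Finset ℕ) {a b : ℤ}
    (ha : a = 0 ∨ a = 1) (hb : b = 0 ∨ b = 1) :
    lowerSum z (bitCons m μ) (bitCons n ν) a b =
      z ^ b.toNat * 2 ^ m.toNat * lowerSum z μ ν (a - m.toNat) (b - n.toNat) +
      z ^ b.toNat * 2 ^ (!n).toNat * lowerSum z μ ν (a + 1 - m.toNat) (b + 1 - n.toNat) := by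
  simp only [lowerSum]
  rw [tsum_bitCons]
  simp [lowerTerm_bitCons z _ _ _ _ _ _ ha hb, ENNReal.tsum_mul_left]

lemma upperSum_eq_zero (z : ℝ≥0∞) (μ ν : Finset ℕ) {a b : ℤ}
    (h : a < 0 ∨ 1 < a ∨ b < 0 ∨ 1 < b) : upperSum z μ ν a b = 0 := by
  refine ENNReal.tsum_eq_zero.2 fun S => if_neg ?_
  rintro ⟨h1, h2, h3, h4⟩
  have := h1.card_le
  have := h2.card_le
  omega

lemma lowerSum_eq_zero (z : ℝ≥0∞) (μ ν : Finset ℕ) {a b : ℤ}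
    (h : a < 0 ∨ 1 < a ∨ b < 0 ∨ 1 < b) : lowerSum z μ ν a b = 0 := by
  refine ENNReal.tsum_eq_zero.2 fun S => if_neg ?_
  rintro ⟨h1, h2, h3, h4⟩
  have := h1.card_le
  have := h2.card_le
  omega

lemma tsum_pow_eq (z : ℝ≥0∞) : ∑' k, z ^ k = 1 + z * ∑' k, z ^ k := by
  conv_lhs => rw [tsum_eq_zero_add' ENNReal.summable]
  simp [pow_succ', ENNReal.tsum_mul_left]

/-- The power series of `(1 + z) / (1 - z)`. -/
noncomputable def cayley (z : ℝ≥0∞) : ℝ≥0∞ := (1 + z) * ∑' k, z ^ k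

@[simp] lemma partSum_empty : partSum ∅ = 0 := rfl

@[simp] lemma partCount_empty (v : ℕ) : partCount ∅ v = 0 := rfl

@[simp] lemma interlace_empty_left {S : Finset ℕ} : Interlace ∅ S ↔ S = ∅ := by
  refine ⟨fun h => ?_, fun h v => by simp [h]⟩
  simpa using h.card_le.1

lemma interlace_empty_right {S : Finset ℕ} : Interlace S ∅ ↔ #S ≤ 1 := by
  refine ⟨fun h => by simpa using h.card_le.2, fun h v => ?_⟩
  simpa [partCount] using (card_filter_le _ _).trans h

lemma upperSum_empty (z : ℝ≥0∞) (a b : ℤ) :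
    upperSum z ∅ ∅ a b =
      if a = 0 ∧ b = 0 then 1 else if a = 1 ∧ b = 1 then 2 * z * ∑' k, z ^ k else 0 := by
  rw [upperSum]
  split_ifs with h h'
  · rw [tsum_eq_single ∅]
    · simp [upperTerm, h]
    · intro S hS
      refine if_neg ?_
      rintro ⟨-, -, h3, -⟩
      simp [h] at h3
      exact hS h3
  · rw [← (singleton_injective (α := ℕ)).tsum_eq]
    · rw [← ENNReal.tsum_mul_left]
      refine tsum_congr fun k => ?_
      simp [upperTerm, interlace_empty_right, h', partSum]
      ring
    · intro S hS
      by_contra hS'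
      refine hS (if_neg ?_)
      rintro ⟨-, -, h3, -⟩
      have : #S = 1 := by simp [h'] at h3; exact_mod_cast h3
      obtain ⟨k, rfl⟩ := card_eq_one.1 this
      exact hS' ⟨k, rfl⟩
  · refine ENNReal.tsum_eq_zero.2 fun S => if_neg ?_
    rintro ⟨h1, -, h3, h4⟩
    have := h1.card_le
    simp at *
    omega

lemma lowerSum_empty (z : ℝ≥0∞) (a b : ℤ) :
    lowerSum z ∅ ∅ a b = if a = 0 ∧ b = 0 then 1 else 0 := by
  rw [lowerSum, tsum_eq_single ∅]
  · simp [lowerTerm]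
  · intro S hS
    exact if_neg (by simp [hS])

/-- The linear relations between the weighted sums over the strict partitions interlacing two given
ones from above and from below. -/
lemma upperSum_lowerSum (z : ℝ≥0∞) (μ ν : Finset ℕ) :
    upperSum z μ ν 0 0 = lowerSum z μ ν 0 0 + 2 * (∑' k, z ^ k) * lowerSum z μ ν 1 1 ∧
    upperSum z μ ν 1 1 + lowerSum z μ ν 1 1 = 2 * z * (∑' k, z ^ k) * lowerSum z μ ν 0 0 ∧
    upperSum z μ ν 0 0 + upperSum z μ ν 1 1 =
      cayley z * (lowerSum z μ ν 0 0 + lowerSum z μ ν 1 1) ∧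
    upperSum z μ ν 0 1 = cayley z * lowerSum z μ ν 1 0 ∧
    upperSum z μ ν 1 0 = cayley z * lowerSum z μ ν 0 1 := by
  have he := tsum_pow_eq z
  unfold cayley
  induction μ, ν using bitCons_induction₂ with
  | empty =>
    simp only [upperSum_empty, lowerSum_empty]
    generalize ∑' k, z ^ k = e at *
    have hc : (1 + z) * e = 1 + 2 * z * e := by
      calc (1 + z) * e = e + z * e := by ring
        _ = 1 + z * e + z * e := by rw [← he]
        _ = _ := by ring
    simp [hc]
  | cons m n μ ν ih =>
    obtain ⟨h1, h2, h3, h4, h5⟩ := ih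
    generalize ∑' k, z ^ k = e at *
    have l0 : ∀ a b : ℤ, (a < 0 ∨ 1 < a ∨ b < 0 ∨ 1 < b) → lowerSum z μ ν a b = 0 :=
      fun a b => lowerSum_eq_zero z μ ν
    have u0 : ∀ a b : ℤ, (a < 0 ∨ 1 < a ∨ b < 0 ∨ 1 < b) → upperSum z μ ν a b = 0 :=
      fun a b => upperSum_eq_zero z μ ν
    have hc : (1 + z) * e = 1 + 2 * z * e := by
      calc (1 + z) * e = e + z * e := by ring
        _ = 1 + z * e + z * e := by rw [← he]
        _ = _ := by ring
    have hc' : 1 + (1 + z) * e = 2 * e := by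
      calc 1 + (1 + z) * e = (1 + z * e) + e := by ring
        _ = _ := by rw [← he]; ring
    cases m <;> cases n <;> simp [upperSum_bitCons, lowerSum_bitCons, l0, u0] <;>
      generalize upperSum z μ ν 0 0 = F₀ at *  <;> generalize upperSum z μ ν 1 1 = F₁ at * <;>
      generalize upperSum z μ ν 0 1 = F at * <;> generalize upperSum z μ ν 1 0 = F' at * <;>
      generalize lowerSum z μ ν 0 0 = G₀ at * <;> generalize lowerSum z μ ν 1 1 = G₁ at * <;>
      generalize lowerSum z μ ν 1 0 = G at * <;> generalize lowerSum z μ ν 0 1 = G' at *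
    · refine ⟨?_, ?_, ?_, h4, by rw [h5]; ring⟩
      · calc F₀ = G₀ + 2 * (1 + z * e) * G₁ := by rw [← he, h1]
          _ = _ := by ring
      · calc z * F₁ + z * 2 * F₀ + z * G₁ = z * (F₁ + G₁) + 2 * z * F₀ := by ring
          _ = 2 * z * (1 + z * e) * G₀ + 4 * z * e * G₁ := by rw [h2, h1]; ring
          _ = _ := by rw [← he]; ring
      · calc F₀ + (z * F₁ + z * 2 * F₀) = z * (F₀ + F₁) + (1 + z) * F₀ := by ring
          _ = (1 + z) * (1 + z * e) * G₀ + (1 + z) * e * (2 + z) * G₁ := by rw [h3, h1]; ring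
          _ = _ := by rw [← he]; ring
    · refine ⟨?_, ?_, by rw [h4]; ring, ?_⟩
      · rw [h4, hc]; ring
      · calc z * F + z * G = z * (1 + (1 + z) * e) * G := by rw [h4]; ring
          _ = _ := by rw [hc']; ring
      · calc z * F₁ + z * F₀ = z * (F₀ + F₁) := by ring
          _ = _ := by rw [h3]; ring
    · refine ⟨?_, ?_, by rw [h5]; ring, ?_⟩
      · rw [h5, hc]; ring
      · calc z * 2 * F' + z * 2 * G' = z * 2 * (1 + (1 + z) * e) * G' := by rw [h5]; ring
          _ = _ := by rw [hc']; ring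
      · calc 2 * F₁ + 2 * F₀ = 2 * (F₀ + F₁) := by ring
          _ = _ := by rw [h3]; ring
    · refine ⟨?_, ?_, ?_, h4, by rw [h5]; ring⟩
      · calc 2 * F₁ + F₀ = 2 * F₁ + (G₀ + 2 * (1 + z * e) * G₁) := by rw [← he, h1]
          _ = 2 * (F₁ + G₁) + G₀ + 2 * z * e * G₁ := by ring
          _ = _ := by rw [h2]; ring
      · calc z * F₁ + (z * 2 * G₀ + z * G₁) = z * (F₁ + G₁) + 2 * z * G₀ := by ring
          _ = 2 * z * (1 + z * e) * G₀ := by rw [h2]; ring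
          _ = _ := by rw [← he]
      · calc 2 * F₁ + F₀ + z * F₁ = (F₀ + F₁) + (1 + z) * F₁ := by ring
          _ = (1 + z) * e * G₀ + (1 + z) * e * G₁ + (1 + z) * F₁ := by rw [h3]; ring
          _ = (1 + z) * e * G₀ + (1 + z) * (1 + z * e) * G₁ + (1 + z) * F₁ := by rw [← he]
          _ = (1 + z) * e * G₀ + (1 + z) * z * e * G₁ + (1 + z) * (F₁ + G₁) := by ring
          _ = _ := by rw [h2]; ring

/-- The weight of a step from a strict partition `S` to a smaller one `T` on the left. -/
noncomputable def leftStep (S T : Finset ℕ) : ℝ≥0∞ :=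
  open Classical in if Interlace S T then 2 ^ #(S \ T) else 0

/-- The weight of a step from a strict partition `S` to a smaller one `T` on the right. -/
noncomputable def rightStep (S T : Finset ℕ) : ℝ≥0∞ :=
  open Classical in if Interlace S T then 2 ^ #(T \ S) else 0

lemma tsum_upperTerm (z : ℝ≥0∞) (μ ν : Finset ℕ) :
    ∑' S, rightStep S μ * leftStep S ν * z ^ (partSum S - partSum μ) =
      (upperSum z μ ν 0 0 + upperSum z μ ν 1 1) + upperSum z μ ν 0 1 + upperSum z μ ν 1 0 := by
  simp only [upperSum, ← ENNReal.tsum_add]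
  refine tsum_congr fun S => ?_
  simp only [rightStep, leftStep, upperTerm]
  by_cases h1 : Interlace S μ <;> by_cases h2 : Interlace S ν <;>
    simp only [h1, h2, if_true, if_false, true_and, false_and, zero_mul, mul_zero, add_zero]
  obtain h3 | h3 : (#μ : ℤ) = #S ∨ (#μ : ℤ) = #S - 1 := by have := h1.card_le; omega
  all_goals
    obtain h4 | h4 : (#ν : ℤ) = #S ∨ (#ν : ℤ) = #S - 1 := by have := h2.card_le; omega
    all_goals
      have h5 : (#S : ℤ) ≠ #S - 1 := by omega
      simp [h3, h4, h5]

lemma tsum_lowerTerm (z : ℝ≥0∞) (μ ν : Finset ℕ) :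
    ∑' S, rightStep ν S * leftStep μ S * z ^ (partSum ν - partSum S) =
      (lowerSum z μ ν 0 0 + lowerSum z μ ν 1 1) + lowerSum z μ ν 1 0 + lowerSum z μ ν 0 1 := by
  simp only [lowerSum, ← ENNReal.tsum_add]
  refine tsum_congr fun S => ?_
  simp only [rightStep, leftStep, lowerTerm]
  by_cases h1 : Interlace μ S <;> by_cases h2 : Interlace ν S <;>
    simp only [h1, h2, if_true, if_false, true_and, false_and, zero_mul, mul_zero, add_zero]
  obtain h3 | h3 : #μ = #S ∨ #μ = #S + 1 := by have := h1.card_le; omega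
  all_goals
    obtain h4 | h4 : #ν = #S ∨ #ν = #S + 1 := by have := h2.card_le; omega
    all_goals
      zify at h3 h4
      simp [h3, h4]

/-- The commutation relation between the operators adding and removing strips. -/
lemma tsum_rightStep_mul_leftStep (z : ℝ≥0∞) (μ ν : Finset ℕ) :
    ∑' S, rightStep S μ * leftStep S ν * z ^ (partSum S - partSum μ) =
      cayley z * ∑' S, rightStep ν S * leftStep μ S * z ^ (partSum ν - partSum S) := by
  obtain ⟨-, -, h3, h4, h5⟩ := upperSum_lowerSum z μ ν
  rw [tsum_upperTerm, tsum_lowerTerm, h3, h4, h5]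
  ring

/-- The sum over all chains of `N` steps from `S` to the empty partition, where each step has
weight `w`. -/
noncomputable def chainSum (w : Finset ℕ → Finset ℕ → ℝ≥0∞) : ℕ → Finset ℕ → ℝ≥0∞
  | 0, S => if S = ∅ then 1 else 0
  | N + 1, S => ∑' T, w S T * chainSum w N T

/-- The equivalence between sequences and pairs of a first term and a remaining sequence. -/
def consSeqEquiv (α : Type*) : α × (ℕ → α) ≃ (ℕ → α) where
  toFun p := fun k => Nat.casesOn k p.1 p.2
  invFun f := (f 0, fun k => f (k + 1))
  left_inv _ := rfl
  right_inv f := by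
    ext k
    cases k <;> rfl

open Classical in
lemma chainSum_eq_tsum (w : Finset ℕ → Finset ℕ → ℝ≥0∞) (N : ℕ) (S : Finset ℕ) :
    chainSum w N S = ∑' f : ℕ → Finset ℕ,
      if f 0 = S ∧ ∀ k, N ≤ k → f k = ∅ then ∏ k ∈ range N, w (f k) (f (k + 1)) else 0 := by
  induction N generalizing S with
  | zero =>
    rw [tsum_eq_single (fun _ => ∅)]
    · simp [chainSum, eq_comm]
    · intro f hf
      refine if_neg fun h => hf ?_
      ext1 k
      exact h.2 k (Nat.zero_le k)
  | succ N ih =>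
    rw [← (consSeqEquiv (Finset ℕ)).tsum_eq]
    change _ = ∑' p : Finset ℕ × (ℕ → Finset ℕ), _
    rw [ENNReal.tsum_prod', tsum_eq_single S, chainSum]
    · simp_rw [ih, ← ENNReal.tsum_mul_left]
      rw [ENNReal.tsum_comm]
      refine tsum_congr fun f => ?_
      rw [tsum_eq_single (f 0)]
      · have : (∀ k, N + 1 ≤ k → consSeqEquiv (Finset ℕ) (S, f) k = ∅) ↔ ∀ k, N ≤ k → f k = ∅ := by
          refine ⟨fun h k hk => h (k + 1) (by omega), fun h k hk => ?_⟩
          obtain ⟨k, rfl⟩ := Nat.exists_eq_add_of_le' (show 1 ≤ k by omega)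
          exact h k (by omega)
        rw [this, prod_range_succ']
        simp only [true_and, mul_ite, mul_zero]
        simp [consSeqEquiv, mul_comm]
      · intro T hT
        simp [hT.symm]
    · intro T hT
      refine ENNReal.tsum_eq_zero.2 fun f => if_neg fun h => hT h.1

/-- Generating function of the left halves of strict plane partitions with main diagonal `S`. -/
noncomputable def leftSum (s : ℝ≥0∞) : ℕ → Finset ℕ → ℝ≥0∞ :=
  chainSum fun S T => leftStep S T * s ^ partSum T

/-- Generating function of the right halves of strict plane partitions with main diagonal `S`. -/
noncomputable def rightSum (s : ℝ≥0∞) : ℕ → Finset ℕ → ℝ≥0∞ :=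
  chainSum fun S T => rightStep S T * s ^ partSum T

lemma leftSum_succ (s : ℝ≥0∞) (M : ℕ) (S : Finset ℕ) :
    leftSum s (M + 1) S = ∑' T, leftStep S T * s ^ partSum T * leftSum s M T := rfl

lemma rightSum_succ (s : ℝ≥0∞) (N : ℕ) (S : Finset ℕ) :
    rightSum s (N + 1) S = ∑' T, rightStep S T * s ^ partSum T * rightSum s N T := rfl

lemma tsum_rightStep_mul_leftSum (s z : ℝ≥0∞) (M : ℕ) (μ : Finset ℕ) :
    ∑' S, rightStep S μ * z ^ (partSum S - partSum μ) * leftSum s M S =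
      (∏ i ∈ range M, cayley (z * s ^ i)) * leftSum s M μ := by
  induction M generalizing z μ with
  | zero =>
    rw [tsum_eq_single ∅]
    · by_cases h : μ = ∅ <;> simp [leftSum, chainSum, rightStep, h]
    · intro S hS
      simp [leftSum, chainSum, hS]
  | succ M ih =>
    calc ∑' S, rightStep S μ * z ^ (partSum S - partSum μ) * leftSum s (M + 1) S
        = ∑' ν, (∑' S, rightStep S μ * leftStep S ν * z ^ (partSum S - partSum μ)) *
            (s ^ partSum ν * leftSum s M ν) := by
          simp only [leftSum_succ, ← ENNReal.tsum_mul_left, ← ENNReal.tsum_mul_right]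
          rw [ENNReal.tsum_comm]
          refine tsum_congr fun ν => tsum_congr fun S => ?_
          ring
      _ = cayley z * ∑' T, leftStep μ T * s ^ partSum T *
            ∑' ν, rightStep ν T * (z * s) ^ (partSum ν - partSum T) * leftSum s M ν := by
          simp only [tsum_rightStep_mul_leftStep, ← ENNReal.tsum_mul_left,
            ← ENNReal.tsum_mul_right]
          rw [ENNReal.tsum_comm]
          refine tsum_congr fun T => tsum_congr fun ν => ?_
          by_cases h : Interlace ν T
          · have : s ^ partSum ν = s ^ partSum T * s ^ (partSum ν - partSum T) := by
              rw [← pow_add, Nat.add_sub_cancel' h.partSum_le]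
            rw [this, mul_pow]
            ring
          · simp [rightStep, h]
      _ = _ := by
          simp only [ih, leftSum_succ]
          rw [prod_range_succ', ← ENNReal.tsum_mul_left, ← ENNReal.tsum_mul_left]
          refine tsum_congr fun T => ?_
          simp only [pow_succ', pow_zero, mul_one, mul_assoc]
          ring

lemma leftSum_empty (s : ℝ≥0∞) (M : ℕ) : leftSum s M ∅ = 1 := by
  induction M with
  | zero => simp [leftSum, chainSum]
  | succ M ih =>
    rw [leftSum_succ, tsum_eq_single ∅]
    · simp [leftStep, ih]
    · intro T hT
      simp [leftStep, hT]

lemma tsum_leftSum_mul_rightSum (s : ℝ≥0∞) (r M N : ℕ) :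
    ∑' S, (s ^ r) ^ partSum S * leftSum s M S * rightSum s N S =
      ∏ j ∈ range N, ∏ i ∈ range M, cayley (s ^ (r + j + i)) := by
  induction N generalizing r with
  | zero =>
    rw [tsum_eq_single ∅]
    · simp [rightSum, chainSum, leftSum_empty]
    · intro S hS
      simp [rightSum, chainSum, hS]
  | succ N ih =>
    calc ∑' S, (s ^ r) ^ partSum S * leftSum s M S * rightSum s (N + 1) S
        = ∑' T, (s ^ (r + 1)) ^ partSum T * rightSum s N T *
            ∑' S, rightStep S T * (s ^ r) ^ (partSum S - partSum T) * leftSum s M S := by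
          simp only [rightSum_succ, ← ENNReal.tsum_mul_left]
          rw [ENNReal.tsum_comm]
          refine tsum_congr fun T => tsum_congr fun S => ?_
          by_cases h : Interlace S T
          · have : (s ^ r) ^ partSum S = (s ^ r) ^ partSum T * (s ^ r) ^ (partSum S - partSum T) := by
              rw [← pow_add, Nat.add_sub_cancel' h.partSum_le]
            rw [this, pow_succ s r, mul_pow]
            ring
          · simp [rightStep, h]
      _ = (∏ i ∈ range M, cayley (s ^ (r + i))) *
            ∑' T, (s ^ (r + 1)) ^ partSum T * leftSum s M T * rightSum s N T := by
          simp only [tsum_rightStep_mul_leftSum, ← ENNReal.tsum_mul_left, ← pow_add]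
          refine tsum_congr fun T => ?_
          ring
      _ = _ := by
          rw [ih, prod_range_succ', mul_comm]
          simp only [add_zero]
          congr! 6
          ring

/-! ### Strict partitions as sequences -/

/-- A weakly decreasing sequence that ends in zeros and has no repeated nonzero terms. -/
def IsStrictSeq (d : ℕ → ℕ) : Prop :=
  Antitone d ∧ (∀ i, d i ≠ 0 → d (i + 1) < d i) ∧ ∃ M, d M = 0

/-- The finset encoding the strict partition given by a sequence. -/
noncomputable def partSet (d : ℕ → ℕ) : Finset ℕ :=
  open Classical in {v ∈ range (d 0) | ∃ i, d i = v + 1}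

lemma mem_partSet {d : ℕ → ℕ} (hd : Antitone d) {v : ℕ} : v ∈ partSet d ↔ ∃ i, d i = v + 1 := by
  classical
  simp only [partSet, mem_filter, mem_range, and_iff_right_iff_imp]
  rintro ⟨i, hi⟩
  have := hd (Nat.zero_le i)
  omega

lemma IsStrictSeq.lt {d : ℕ → ℕ} (hd : IsStrictSeq d) {i j : ℕ} (hij : i < j) (hi : d i ≠ 0) :
    d j < d i :=
  (hd.1 hij).trans_lt (hd.2.1 i hi)

lemma IsStrictSeq.eq_of_eq {d : ℕ → ℕ} (hd : IsStrictSeq d) {i j : ℕ} (hi : d i ≠ 0)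
    (h : d i = d j) : i = j := by
  rcases lt_trichotomy i j with hij | hij | hij
  · have := hd.lt hij hi
    omega
  · exact hij
  · have := hd.lt hij (h ▸ hi)
    omega

lemma IsStrictSeq.lt_partCount {d : ℕ → ℕ} (hd : IsStrictSeq d) {i v : ℕ} :
    i < partCount (partSet d) v ↔ v < d i := by
  have hex : ∃ i, d i ≤ v := hd.2.2.imp fun M hM => by omega
  have hm : ∀ i, v < d i ↔ i < Nat.find hex := fun i => by
    rw [Nat.lt_find_iff]
    refine ⟨fun h j hj => ?_, fun h => not_le.1 (h i le_rfl)⟩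
    have := hd.1 hj
    omega
  rw [hm, partCount]
  suffices h : {j ∈ partSet d | v ≤ j} = (range (Nat.find hex)).image fun i => d i - 1 by
    rw [h, card_image_of_injOn, card_range]
    intro i hi j hj hij
    have hi' := (hm i).2 (by simpa using hi)
    have hj' := (hm j).2 (by simpa using hj)
    simp only at hij
    exact hd.eq_of_eq (by omega) (by omega)
  ext j
  simp only [mem_filter, mem_partSet hd.1, mem_image, mem_range, ← hm]
  constructor
  · rintro ⟨⟨i, hi⟩, hj⟩
    exact ⟨i, by omega, by omega⟩
  · rintro ⟨i, hi, rfl⟩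
    exact ⟨⟨i, by omega⟩, by omega⟩

lemma partCount_eq_add (S : Finset ℕ) (v : ℕ) :
    partCount S v = partCount S (v + 1) + if v ∈ S then 1 else 0 := by
  have : (if v ∈ S then 1 else 0) = ∑ j ∈ S, if j = v then 1 else 0 := by
    rw [sum_ite_eq']
  rw [partCount, partCount, card_filter, card_filter, this, ← sum_add_distrib]
  refine sum_congr rfl fun j _ => ?_
  split_ifs <;> omega

lemma ext_partCount {S T : Finset ℕ} (h : ∀ v, partCount S v = partCount T v) : S = T := by
  ext v
  have hS := partCount_eq_add S v
  have hT := partCount_eq_add T v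
  rw [h, h] at hS
  split_ifs at hS hT <;> simp_all

lemma exists_partCount_le (S : Finset ℕ) (i : ℕ) : ∃ v, partCount S v ≤ i := by
  obtain ⟨N, hN⟩ := S.exists_nat_subset_range
  refine ⟨N, ?_⟩
  rw [partCount, filter_false_of_mem]
  · simp
  · intro j hj
    simpa using hN hj

/-- The sequence of parts of the strict partition encoded by `S`, in decreasing order. -/
def nthPart (S : Finset ℕ) (i : ℕ) : ℕ := Nat.find (exists_partCount_le S i)

lemma partCount_antitone (S : Finset ℕ) : Antitone (partCount S) :=
  antitone_nat_of_succ_le fun v => by rw [partCount_eq_add S v]; omega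

lemma lt_nthPart {S : Finset ℕ} {i v : ℕ} : v < nthPart S i ↔ i < partCount S v := by
  rw [nthPart, Nat.lt_find_iff]
  refine ⟨fun h => not_le.1 (h v le_rfl), fun h u hu => ?_⟩
  have := partCount_antitone S hu
  omega

lemma isStrictSeq_nthPart (S : Finset ℕ) : IsStrictSeq (nthPart S) := by
  refine ⟨fun i j hij => ?_, fun i hi => ?_, #S, ?_⟩
  · refine le_of_forall_lt fun v hv => ?_
    rw [lt_nthPart] at hv ⊢
    omega
  · obtain ⟨v, hv⟩ := Nat.exists_eq_succ_of_ne_zero hi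
    have h1 : ¬ v + 1 < nthPart S i := by omega
    have h2 : ¬ v < nthPart S (i + 1) → nthPart S (i + 1) < nthPart S i := by omega
    refine h2 ?_
    rw [lt_nthPart] at h1 ⊢
    rw [partCount_eq_add]
    split_ifs <;> omega
  · by_contra h
    have := lt_nthPart.1 (Nat.pos_of_ne_zero h)
    rw [partCount_zero] at this
    omega

lemma partSet_nthPart (S : Finset ℕ) : partSet (nthPart S) = S :=
  ext_partCount fun v => eq_of_forall_lt_iff fun i => by
    rw [(isStrictSeq_nthPart S).lt_partCount, lt_nthPart]

lemma partSet_injOn {d d' : ℕ → ℕ} (hd : IsStrictSeq d) (hd' : IsStrictSeq d')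
    (h : partSet d = partSet d') : d = d' := by
  ext1 i
  refine eq_of_forall_lt_iff fun v => ?_
  rw [← hd.lt_partCount, ← hd'.lt_partCount, h]

lemma interlace_partSet {d d' : ℕ → ℕ} (hd : IsStrictSeq d) (hd' : IsStrictSeq d') :
    Interlace (partSet d) (partSet d') ↔ ∀ i, d' i ≤ d i ∧ d (i + 1) ≤ d' i := by
  constructor
  · intro h i
    constructor
    · refine le_of_forall_lt fun v hv => ?_
      rw [← hd.lt_partCount]
      rw [← hd'.lt_partCount] at hv
      exact hv.trans_le (h v).1
    · refine le_of_forall_lt fun v hv => ?_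
      rw [← hd'.lt_partCount]
      rw [← hd.lt_partCount] at hv
      have := (h v).2
      omega
  · intro h v
    constructor
    · refine le_of_forall_lt fun i hi => ?_
      rw [hd.lt_partCount]
      rw [hd'.lt_partCount] at hi
      exact hi.trans_le (h i).1
    · refine le_of_forall_lt fun i hi => ?_
      rcases i with _ | i
      · omega
      rw [Nat.add_lt_add_iff_right, hd'.lt_partCount]
      rw [hd.lt_partCount] at hi
      exact hi.trans_le (h i).2

lemma sum_partSet {d : ℕ → ℕ} (hd : IsStrictSeq d) {N : ℕ} (hN : d N = 0) (f : ℕ → ℕ) :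
    ∑ v ∈ partSet d, f v = ∑ i ∈ range N, if d i = 0 then 0 else f (d i - 1) := by
  have h : partSet d = {i ∈ range N | d i ≠ 0}.image fun i => d i - 1 := by
    ext v
    simp only [mem_partSet hd.1, mem_image, mem_filter, mem_range]
    constructor
    · rintro ⟨i, hi⟩
      refine ⟨i, ⟨?_, by omega⟩, by omega⟩
      by_contra hi'
      have := hd.1 (not_lt.1 hi')
      omega
    · rintro ⟨i, ⟨-, hi⟩, rfl⟩
      exact ⟨i, by omega⟩
  rw [h, sum_image, sum_filter]
  · simp only [ne_eq, ite_not]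
  · intro i hi j hj hij
    simp only [coe_filter, mem_range, Set.mem_ofPred_eq] at hi hj hij
    exact hd.eq_of_eq hi.2 (by omega)

lemma partSet_eq_empty {d : ℕ → ℕ} (hd : IsStrictSeq d) : partSet d = ∅ ↔ d 0 = 0 := by
  rw [← card_eq_zero, ← partCount_zero, ← not_iff_not, ← ne_eq, ← ne_eq, ← Nat.pos_iff_ne_zero,
    ← Nat.pos_iff_ne_zero, hd.lt_partCount]

namespace PlanePartition

lemma part_le (π : PlanePartition) {i i' j j' : ℕ} (hi : i ≤ i') (hj : j ≤ j') :
    π.part i' j' ≤ π.part i j :=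
  (antitone_nat_of_succ_le (f := fun i => π.part i j') (fun i => π.col_decr i j') hi).trans
    (antitone_nat_of_succ_le (f := π.part i) (π.row_decr i) hj)

/-- The support is contained in the square of side `N`. -/
def Fits (π : PlanePartition) (N : ℕ) : Prop := π.part 0 N = 0 ∧ π.part N 0 = 0

lemma Fits.part_eq_zero {π : PlanePartition} {N : ℕ} (h : π.Fits N) {i j : ℕ}
    (hij : N ≤ i ∨ N ≤ j) : π.part i j = 0 := by
  rcases hij with hi | hj
  · exact Nat.le_zero.1 (h.2 ▸ π.part_le hi (Nat.zero_le j))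
  · exact Nat.le_zero.1 (h.1 ▸ π.part_le (Nat.zero_le i) hj)

lemma exists_fits (π : PlanePartition) : ∃ N, ∀ M, N ≤ M → π.Fits M := by
  obtain ⟨⟨a, b⟩, h⟩ := π.finite_supp.bddAbove
  refine ⟨a + b + 1, fun M hM => ⟨?_, ?_⟩⟩
  · by_contra h0
    have := (h (show (0, M) ∈ _ from h0)).2
    simp only at this
    omega
  · by_contra h0
    have := (h (show (M, 0) ∈ _ from h0)).1
    simp only at this
    omega

/-- The diagonal at distance `k` to the right of the main diagonal. -/
def rightDiag (π : PlanePartition) (k i : ℕ) : ℕ := π.part i (i + k)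

/-- The diagonal at distance `k` to the left of the main diagonal. -/
def leftDiag (π : PlanePartition) (k i : ℕ) : ℕ := π.part (i + k) i

lemma IsStrict.isStrictSeq_rightDiag {π : PlanePartition} (hπ : π.IsStrict) (k : ℕ) :
    IsStrictSeq (π.rightDiag k) := by
  refine ⟨fun i j hij => π.part_le hij (by omega), fun i hi => ?_, ?_⟩
  · have := hπ i (i + k) hi
    rwa [rightDiag, rightDiag, show i + 1 + k = i + k + 1 by ring]
  · obtain ⟨N, hN⟩ := π.exists_fits
    exact ⟨N, (hN N le_rfl).part_eq_zero (Or.inl le_rfl)⟩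

lemma IsStrict.isStrictSeq_leftDiag {π : PlanePartition} (hπ : π.IsStrict) (k : ℕ) :
    IsStrictSeq (π.leftDiag k) := by
  refine ⟨fun i j hij => π.part_le (by omega) hij, fun i hi => ?_, ?_⟩
  · have := hπ (i + k) i hi
    rwa [leftDiag, leftDiag, show i + 1 + k = i + k + 1 by ring]
  · obtain ⟨N, hN⟩ := π.exists_fits
    exact ⟨N, (hN N le_rfl).part_eq_zero (Or.inr le_rfl)⟩

/-- The strict partitions to the right of the main diagonal. -/
noncomputable def rightSet (π : PlanePartition) (k : ℕ) : Finset ℕ := partSet (π.rightDiag k)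

/-- The strict partitions to the left of the main diagonal. -/
noncomputable def leftSet (π : PlanePartition) (k : ℕ) : Finset ℕ := partSet (π.leftDiag k)

lemma IsStrict.interlace_rightSet {π : PlanePartition} (hπ : π.IsStrict) (k : ℕ) :
    Interlace (π.rightSet k) (π.rightSet (k + 1)) :=
  (interlace_partSet (hπ.isStrictSeq_rightDiag k) (hπ.isStrictSeq_rightDiag (k + 1))).2 fun i =>
    ⟨π.part_le le_rfl (by omega), π.part_le (by omega) (by omega)⟩

lemma IsStrict.interlace_leftSet {π : PlanePartition} (hπ : π.IsStrict) (k : ℕ) :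
    Interlace (π.leftSet k) (π.leftSet (k + 1)) :=
  (interlace_partSet (hπ.isStrictSeq_leftDiag k) (hπ.isStrictSeq_leftDiag (k + 1))).2 fun i =>
    ⟨π.part_le (by omega) le_rfl, π.part_le (by omega) (by omega)⟩

lemma IsStrict.rightSet_eq_empty {π : PlanePartition} (hπ : π.IsStrict) {N k : ℕ} (h : π.Fits N)
    (hk : N ≤ k) : π.rightSet k = ∅ :=
  (partSet_eq_empty (hπ.isStrictSeq_rightDiag k)).2 (h.part_eq_zero (Or.inr (by omega)))

lemma IsStrict.leftSet_eq_empty {π : PlanePartition} (hπ : π.IsStrict) {N k : ℕ} (h : π.Fits N)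
    (hk : N ≤ k) : π.leftSet k = ∅ :=
  (partSet_eq_empty (hπ.isStrictSeq_leftDiag k)).2 (h.part_eq_zero (Or.inl (by omega)))

lemma ext_part {π ρ : PlanePartition} (h : π.part = ρ.part) : π = ρ := by
  cases π; cases ρ; simp_all

lemma IsStrict.ext_sets {π ρ : PlanePartition} (hπ : π.IsStrict) (hρ : ρ.IsStrict)
    (hl : π.leftSet = ρ.leftSet) (hr : π.rightSet = ρ.rightSet) : π = ρ := by
  refine ext_part (funext₂ fun i j => ?_)
  rcases le_total i j with hij | hij
  · obtain ⟨k, rfl⟩ := Nat.exists_eq_add_of_le hij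
    exact congrFun (partSet_injOn (hπ.isStrictSeq_rightDiag k) (hρ.isStrictSeq_rightDiag k)
      (congrFun hr k)) i
  · obtain ⟨k, rfl⟩ := Nat.exists_eq_add_of_le hij
    exact congrFun (partSet_injOn (hπ.isStrictSeq_leftDiag k) (hρ.isStrictSeq_leftDiag k)
      (congrFun hl k)) j

/-- Every pair of interlacing sequences ending in empty partitions comes from a strict plane
partition. -/
lemma exists_of_interlace {L R : ℕ → Finset ℕ} {N : ℕ} (h0 : L 0 = R 0)
    (hL : ∀ k, Interlace (L k) (L (k + 1))) (hR : ∀ k, Interlace (R k) (R (k + 1)))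
    (hLN : L N = ∅) (hRN : R N = ∅) :
    ∃ π : PlanePartition, π.IsStrict ∧ π.Fits N ∧ π.leftSet = L ∧ π.rightSet = R := by
  have aux : ∀ {S T : Finset ℕ}, Interlace S T →
      ∀ i, nthPart T i ≤ nthPart S i ∧ nthPart S (i + 1) ≤ nthPart T i := by
    intro S T h
    rwa [← interlace_partSet (isStrictSeq_nthPart S) (isStrictSeq_nthPart T), partSet_nthPart,
      partSet_nthPart]
  have hempty : ∀ i, nthPart ∅ i = 0 := fun i => by
    by_contra h
    simpa using lt_nthPart.1 (Nat.pos_of_ne_zero h)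
  let p : ℕ → ℕ → ℕ := fun i j => if i ≤ j then nthPart (R (j - i)) i else nthPart (L (i - j)) j
  have pR : ∀ i k, p i (i + k) = nthPart (R k) i := fun i k => by simp [p]
  have pL : ∀ i k, p (i + k) i = nthPart (L k) i := fun i k => by
    rcases k with _ | k
    · simp [p, h0]
    · simp [p]
  have hrow : ∀ i j, p i (j + 1) ≤ p i j := by
    intro i j
    rcases le_or_gt i j with hij | hij
    · obtain ⟨k, rfl⟩ := Nat.exists_eq_add_of_le hij
      rw [add_assoc, pR, pR]
      exact (aux (hR k) i).1
    · obtain ⟨k, rfl⟩ := Nat.exists_eq_add_of_lt hij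
      rw [show j + k + 1 = (j + 1) + k by ring, pL, show j + 1 + k = j + (k + 1) by ring, pL]
      exact (aux (hL k) j).2
  have hcol : ∀ i j, p (i + 1) j ≤ p i j := by
    intro i j
    rcases le_or_gt j i with hij | hij
    · obtain ⟨k, rfl⟩ := Nat.exists_eq_add_of_le hij
      rw [add_assoc, pL, pL]
      exact (aux (hL k) j).1
    · obtain ⟨k, rfl⟩ := Nat.exists_eq_add_of_lt hij
      rw [show i + k + 1 = (i + 1) + k by ring, pR, show i + 1 + k = i + (k + 1) by ring, pR]
      exact (aux (hR k) i).2
  have h0N : p 0 N = 0 := by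
    have := pR 0 N
    rwa [zero_add, hRN, hempty] at this
  have hN0 : p N 0 = 0 := by
    have := pL 0 N
    rwa [zero_add, hLN, hempty] at this
  have hfin : {q : ℕ × ℕ | p q.1 q.2 ≠ 0}.Finite := by
    refine ((range N ×ˢ range N).finite_toSet).subset ?_
    rintro ⟨i, j⟩ hij
    have h1 : p i j ≤ p 0 j :=
      antitone_nat_of_succ_le (f := fun i => p i j) (fun i => hcol i j) (Nat.zero_le i)
    have h2 : p i j ≤ p i 0 := antitone_nat_of_succ_le (f := p i) (hrow i) (Nat.zero_le j)
    simp only [Set.mem_ofPred_eq] at hij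
    simp only [coe_product, Set.mem_prod, mem_coe, mem_range]
    constructor
    · by_contra h
      have := antitone_nat_of_succ_le (f := fun i => p i 0) (fun i => hcol i 0) (not_lt.1 h)
      simp only at this
      omega
    · by_contra h
      have := antitone_nat_of_succ_le (f := p 0) (hrow 0) (not_lt.1 h)
      omega
  refine ⟨⟨p, hrow, hcol, hfin⟩, ?_, ⟨h0N, hN0⟩, ?_, ?_⟩
  · intro i j hij
    change p i j ≠ 0 at hij
    change p (i + 1) (j + 1) < p i j
    rcases le_total i j with h | h
    · obtain ⟨k, rfl⟩ := Nat.exists_eq_add_of_le h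
      rw [show i + k + 1 = i + 1 + k by ring]
      rw [pR] at hij ⊢
      rw [pR]
      exact (isStrictSeq_nthPart _).2.1 i hij
    · obtain ⟨k, rfl⟩ := Nat.exists_eq_add_of_le h
      rw [show j + k + 1 = j + 1 + k by ring]
      rw [pL] at hij ⊢
      rw [pL]
      exact (isStrictSeq_nthPart _).2.1 j hij
  · ext1 k
    rw [← partSet_nthPart (L k)]
    exact congrArg partSet (funext fun i => pL i k)
  · ext1 k
    rw [← partSet_nthPart (R k)]
    exact congrArg partSet (funext fun i => pR i k)

end PlanePartition

/-! ### Counting connected components -/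

/-- `q` lies on the diagonal next to that of `p`, on its left, and carries the same nonzero
entry. -/
def PredBox (g : ℕ → ℕ → ℕ) (p q : ℕ × ℕ) : Prop :=
  q.2 + 1 + p.1 = p.2 + q.1 ∧ g q.1 q.2 = g p.1 p.2 ∧ g p.1 p.2 ≠ 0

/-- The boxes of the support whose entry does not occur on the next diagonal to the left. -/
def leftEnds (g : ℕ → ℕ → ℕ) : Set (ℕ × ℕ) := {p | g p.1 p.2 ≠ 0 ∧ ∀ q, ¬ PredBox g p q}

lemma ConnStep.predBox {g : ℕ → ℕ → ℕ} {p q : ℕ × ℕ} (h : ConnStep g p q) :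
    PredBox g p q ∨ PredBox g q p := by
  obtain ⟨hadj, hpq, hp⟩ := h
  have hq := hpq ▸ hp
  rcases hadj with ⟨h1, h2 | h2⟩ | ⟨h1, h2 | h2⟩
  · exact Or.inr ⟨by omega, hpq, hq⟩
  · exact Or.inl ⟨by omega, hpq.symm, hp⟩
  · exact Or.inl ⟨by omega, hpq.symm, hp⟩
  · exact Or.inr ⟨by omega, hpq, hq⟩

lemma ConnStep.symm {g : ℕ → ℕ → ℕ} {p q : ℕ × ℕ} (h : ConnStep g p q) : ConnStep g q p := by
  obtain ⟨hadj, hpq, hp⟩ := h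
  refine ⟨?_, hpq.symm, hpq ▸ hp⟩
  unfold Adjacent at hadj ⊢
  omega

lemma SameComponent.symm {g : ℕ → ℕ → ℕ} {p q : ℕ × ℕ} (h : SameComponent g p q) :
    SameComponent g q p := by
  obtain ⟨hp, h⟩ := h
  constructor
  · induction h with
    | refl => exact hp
    | tail _ h _ => exact h.2.1 ▸ h.2.2
  · have : Std.Symm (ConnStep g) := ⟨fun _ _ => ConnStep.symm⟩
    exact Relation.ReflTransGen.stdSymm.symm _ _ h

lemma SameComponent.trans {g : ℕ → ℕ → ℕ} {p q r : ℕ × ℕ} (h : SameComponent g p q)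
    (h' : SameComponent g q r) : SameComponent g p r :=
  ⟨h.1, h.2.trans h'.2⟩

namespace PlanePartition

lemma IsStrict.part_lt {π : PlanePartition} (hπ : π.IsStrict) {i j i' j' : ℕ} (hi : i < i')
    (hj : j < j') (h : π.part i j ≠ 0) : π.part i' j' < π.part i j :=
  (π.part_le hi hj).trans_lt (hπ i j h)

lemma IsStrict.eq_of_part_eq {π : PlanePartition} (hπ : π.IsStrict) {p q : ℕ × ℕ}
    (hpq : p.2 + q.1 = q.2 + p.1) (h : π.part p.1 p.2 = π.part q.1 q.2)
    (h0 : π.part p.1 p.2 ≠ 0) : p = q := by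
  rcases lt_trichotomy p.1 q.1 with h1 | h1 | h1
  · have := hπ.part_lt h1 (j := p.2) (j' := q.2) (by omega) h0
    omega
  · exact Prod.ext h1 (by omega)
  · have := hπ.part_lt h1 (j := q.2) (j' := p.2) (by omega) (h ▸ h0)
    omega

lemma IsStrict.predBox_unique {π : PlanePartition} (hπ : π.IsStrict) {p q r : ℕ × ℕ}
    (hq : PredBox π.part p q) (hr : PredBox π.part p r) : q = r := by
  obtain ⟨h1, h2, h3⟩ := hq
  obtain ⟨h4, h5, -⟩ := hr
  exact hπ.eq_of_part_eq (by omega) (h2.trans h5.symm) (h2 ▸ h3)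

lemma IsStrict.connStep {π : PlanePartition} (hπ : π.IsStrict) {p q : ℕ × ℕ}
    (h : PredBox π.part p q) : ConnStep π.part p q := by
  obtain ⟨h1, h2, h3⟩ := h
  refine ⟨?_, h2.symm, h3⟩
  have h4 : ¬ (p.1 < q.1 ∧ p.2 < q.2) := fun h => by
    have := hπ.part_lt h.1 h.2 h3
    omega
  have h5 : ¬ (q.1 < p.1 ∧ q.2 < p.2) := fun h => by
    have := hπ.part_lt h.1 h.2 (h2 ▸ h3)
    omega
  unfold Adjacent
  omega

lemma IsStrict.reflTransGen_predBox {π : PlanePartition} (hπ : π.IsStrict) {p q : ℕ × ℕ}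
    (hp : p ∈ leftEnds π.part) (h : Relation.ReflTransGen (ConnStep π.part) p q) :
    Relation.ReflTransGen (PredBox π.part) q p := by
  induction h with
  | refl => exact .refl
  | tail _ h ih =>
    rcases h.predBox with h | h
    · rcases Relation.ReflTransGen.cases_head ih with rfl | ⟨c, hc, hcp⟩
      · exact absurd h (hp.2 _)
      · exact hπ.predBox_unique hc h ▸ hcp
    · exact .head h ih

lemma IsStrict.eq_of_sameComponent {π : PlanePartition} (hπ : π.IsStrict) {p q : ℕ × ℕ}
    (hp : p ∈ leftEnds π.part) (hq : q ∈ leftEnds π.part) (h : SameComponent π.part p q) :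
    p = q := by
  rcases Relation.ReflTransGen.cases_head (hπ.reflTransGen_predBox hp h.2) with h | ⟨c, hc, -⟩
  · exact h.symm
  · exact absurd hc (hq.2 c)

lemma IsStrict.exists_leftEnd {π : PlanePartition} (hπ : π.IsStrict) {p : ℕ × ℕ}
    (hp : π.part p.1 p.2 ≠ 0) : ∃ q ∈ leftEnds π.part, SameComponent π.part q p := by
  obtain ⟨N, hN⟩ := π.exists_fits
  have hN := hN N le_rfl
  induction hm : p.2 + (N - p.1) using Nat.strong_induction_on generalizing p with
  | _ m ih =>
    by_cases hE : ∀ q, ¬ PredBox π.part p q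
    · exact ⟨p, ⟨hp, hE⟩, hp, .refl⟩
    · push Not at hE
      obtain ⟨q, hq⟩ := hE
      have hstep := hπ.connStep hq
      have hq0 : π.part q.1 q.2 ≠ 0 := hq.2.1 ▸ hp
      have hqN : q.1 < N := by
        by_contra h
        exact hq0 (hN.part_eq_zero (Or.inl (not_lt.1 h)))
      have hlt : q.2 + (N - q.1) < m := by
        obtain ⟨h1, -, -⟩ := hq
        obtain ⟨h2, -, -⟩ := hstep
        unfold Adjacent at h2
        omega
      obtain ⟨r, hr, hrq⟩ := ih _ hlt hq0 rfl
      exact ⟨r, hr, hrq.trans ⟨hq0, .single hstep.symm⟩⟩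

lemma IsStrict.numComponents_eq {π : PlanePartition} (hπ : π.IsStrict) :
    numComponents π.part = (leftEnds π.part).ncard := by
  have h : components π.part =
      (fun p => {q | SameComponent π.part p q}) '' leftEnds π.part := by
    ext C
    constructor
    · rintro ⟨p, hp, rfl⟩
      obtain ⟨q, hq, hqp⟩ := hπ.exists_leftEnd hp
      exact ⟨q, hq, Set.ext fun r => ⟨hqp.symm.trans, hqp.trans⟩⟩
    · rintro ⟨p, hp, rfl⟩
      exact ⟨p, hp.1, rfl⟩
  rw [numComponents, h, Set.InjOn.ncard_image]
  intro p hp q hq hpq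
  refine hπ.eq_of_sameComponent hp hq ?_
  have : q ∈ {r | SameComponent π.part q r} := ⟨hq.1, .refl⟩
  simp only at hpq
  rwa [← hpq] at this

end PlanePartition

/-! ### Sums over boxes by diagonals -/

lemma finsum_box_eq {f : ℕ → ℕ → ℕ} {N : ℕ} (hf : ∀ i j, N ≤ i ∨ N ≤ j → f i j = 0) :
    ∑ᶠ p : ℕ × ℕ, f p.1 p.2 =
      ∑ k ∈ range N, ∑ i ∈ range N, f i (i + k + 1) +
        ∑ k ∈ range N, ∑ i ∈ range N, f (i + k) i := by
  have hs : Function.support (fun p : ℕ × ℕ => f p.1 p.2) ⊆ (range N ×ˢ range N : Finset _) := by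
    rintro ⟨i, j⟩ h
    simp only [coe_product, Set.mem_prod, mem_coe, mem_range]
    by_contra h'
    exact h (hf i j (by omega))
  rw [finsum_eq_sum_of_support_subset _ hs,
    ← sum_filter_add_sum_filter_not _ fun p : ℕ × ℕ => p.1 < p.2, ← sum_product', ← sum_product']
  congr 1
  · refine sum_of_injOn (fun p => (p.2 - p.1 - 1, p.1)) ?_ ?_ ?_ ?_
    · rintro ⟨i, j⟩ h ⟨i', j'⟩ h' heq
      simp only [coe_filter, mem_product, mem_range, Set.mem_ofPred_eq, Prod.mk.injEq] at h h' heq ⊢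
      omega
    · rintro ⟨i, j⟩ h
      simp only [coe_filter, mem_product, mem_range, Set.mem_ofPred_eq, coe_product,
        Set.mem_prod, mem_coe] at h ⊢
      omega
    · rintro ⟨k, i⟩ h h'
      refine hf _ _ (Or.inr ?_)
      by_contra h''
      simp only [mem_product, mem_range] at h
      exact h' ⟨(i, i + k + 1), by simp; omega, by simp; omega⟩
    · rintro ⟨i, j⟩ h
      simp only [mem_filter, mem_product, mem_range] at h ⊢
      congr 1
      omega
  · refine sum_of_injOn (fun p => (p.1 - p.2, p.2)) ?_ ?_ ?_ ?_
    · rintro ⟨i, j⟩ h ⟨i', j'⟩ h' heq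
      simp only [coe_filter, mem_product, mem_range, Set.mem_ofPred_eq, Prod.mk.injEq] at h h' heq ⊢
      omega
    · rintro ⟨i, j⟩ h
      simp only [coe_filter, mem_product, mem_range, Set.mem_ofPred_eq, coe_product,
        Set.mem_prod, mem_coe] at h ⊢
      omega
    · rintro ⟨k, i⟩ h h'
      refine hf _ _ (Or.inl ?_)
      by_contra h''
      simp only [mem_product, mem_range] at h
      exact h' ⟨(i + k, i), by simp; omega, by simp⟩
    · rintro ⟨i, j⟩ h
      simp only [mem_filter, mem_product, mem_range] at h ⊢
      congr 1
      omega

namespace PlanePartition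

lemma IsStrict.partSum_rightSet {π : PlanePartition} (hπ : π.IsStrict) {N : ℕ} (h : π.Fits N)
    (k : ℕ) : partSum (π.rightSet k) = ∑ i ∈ range N, π.part i (i + k) := by
  rw [partSum, rightSet, sum_partSet (hπ.isStrictSeq_rightDiag k) (h.part_eq_zero (Or.inl le_rfl))]
  refine sum_congr rfl fun i _ => ?_
  rw [rightDiag]
  split_ifs <;> omega

lemma IsStrict.partSum_leftSet {π : PlanePartition} (hπ : π.IsStrict) {N : ℕ} (h : π.Fits N)
    (k : ℕ) : partSum (π.leftSet k) = ∑ i ∈ range N, π.part (i + k) i := by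
  rw [partSum, leftSet, sum_partSet (hπ.isStrictSeq_leftDiag k) (h.part_eq_zero (Or.inr le_rfl))]
  refine sum_congr rfl fun i _ => ?_
  rw [leftDiag]
  split_ifs <;> omega

lemma IsStrict.weight_eq {π : PlanePartition} (hπ : π.IsStrict) {N : ℕ} (h : π.Fits N) :
    π.weight = partSum (π.leftSet 0) + ∑ k ∈ range N, partSum (π.leftSet (k + 1)) +
      ∑ k ∈ range N, partSum (π.rightSet (k + 1)) := by
  rw [weight, finsum_box_eq (N := N) fun i j hij => h.part_eq_zero hij,
    add_comm (partSum (π.leftSet 0)), ← sum_range_succ' fun k => partSum (π.leftSet k),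
    sum_range_succ, hπ.leftSet_eq_empty h le_rfl, partSum_empty, add_zero, add_comm]
  simp only [hπ.partSum_rightSet h, hπ.partSum_leftSet h, add_assoc]

lemma IsStrict.mem_leftEnds_right {π : PlanePartition} (hπ : π.IsStrict) {i k : ℕ} :
    (i, i + k + 1) ∈ leftEnds π.part ↔
      π.rightDiag (k + 1) i ≠ 0 ∧ π.rightDiag (k + 1) i - 1 ∉ π.rightSet k := by
  rw [rightSet, mem_partSet (hπ.isStrictSeq_rightDiag k).1]
  refine and_congr_right fun h0 => ?_
  rw [← not_exists, not_iff_not]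
  change π.part i (i + k + 1) ≠ 0 at h0
  constructor
  · rintro ⟨⟨a, b⟩, h1, h2, -⟩
    simp only at h1 h2
    obtain rfl : b = a + k := by omega
    refine ⟨a, ?_⟩
    rw [rightDiag, rightDiag, h2, ← add_assoc]
    omega
  · rintro ⟨a, ha⟩
    rw [rightDiag, rightDiag, ← add_assoc] at ha
    exact ⟨(a, a + k), by simp only; omega, by simp only; omega, h0⟩

lemma IsStrict.mem_leftEnds_left {π : PlanePartition} (hπ : π.IsStrict) {i k : ℕ} :
    (i + k, i) ∈ leftEnds π.part ↔
      π.leftDiag k i ≠ 0 ∧ π.leftDiag k i - 1 ∉ π.leftSet (k + 1) := by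
  rw [leftSet, mem_partSet (hπ.isStrictSeq_leftDiag (k + 1)).1]
  refine and_congr_right fun h0 => ?_
  rw [← not_exists, not_iff_not]
  change π.part (i + k) i ≠ 0 at h0
  constructor
  · rintro ⟨⟨a, b⟩, h1, h2, -⟩
    simp only at h1 h2
    obtain rfl : a = b + (k + 1) := by omega
    refine ⟨b, ?_⟩
    rw [leftDiag, leftDiag, h2]
    omega
  · rintro ⟨a, ha⟩
    rw [leftDiag, leftDiag] at ha
    exact ⟨(a + (k + 1), a), by simp only; omega, by simp only; omega, h0⟩

lemma IsStrict.numComponents_eq_sum {π : PlanePartition} (hπ : π.IsStrict) {N : ℕ}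
    (h : π.Fits N) :
    numComponents π.part = ∑ k ∈ range N, #(π.leftSet k \ π.leftSet (k + 1)) +
      ∑ k ∈ range N, #(π.rightSet (k + 1) \ π.rightSet k) := by
  classical
  have hE : ∑ᶠ p : ℕ × ℕ, (if (p.1, p.2) ∈ leftEnds π.part then 1 else 0) =
      (leftEnds π.part).ncard := by
    rw [← finsum_one, finsum_mem_def]
    rfl
  have hcard : ∀ S T : Finset ℕ, #(S \ T) = ∑ v ∈ S, if v ∈ T then 0 else 1 := fun S T => by
    rw [sdiff_eq_filter, card_filter]
    exact sum_congr rfl fun v _ => ite_not _ _ _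
  rw [hπ.numComponents_eq, ← hE,
    finsum_box_eq (f := fun i j => if (i, j) ∈ leftEnds π.part then 1 else 0) (N := N)
      fun i j hij => if_neg fun h' => h'.1 (h.part_eq_zero hij), add_comm]
  congr 1
  · refine sum_congr rfl fun k _ => ?_
    rw [hcard, leftSet,
      sum_partSet (hπ.isStrictSeq_leftDiag k) (h.part_eq_zero (Or.inr le_rfl))]
    refine sum_congr rfl fun i _ => ?_
    simp only [hπ.mem_leftEnds_left]
    split_ifs <;> simp_all
  · refine sum_congr rfl fun k _ => ?_
    rw [hcard, rightSet,
      sum_partSet (hπ.isStrictSeq_rightDiag (k + 1)) (h.part_eq_zero (Or.inl le_rfl))]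
    refine sum_congr rfl fun i _ => ?_
    simp only [hπ.mem_leftEnds_right]
    split_ifs <;> simp_all

lemma IsStrict.two_pow_mul_pow {π : PlanePartition} (hπ : π.IsStrict) {N : ℕ} (h : π.Fits N)
    (s : ℝ≥0∞) :
    2 ^ numComponents π.part * s ^ π.weight = s ^ partSum (π.leftSet 0) *
      (∏ k ∈ range N, leftStep (π.leftSet k) (π.leftSet (k + 1)) *
        s ^ partSum (π.leftSet (k + 1))) *
      ∏ k ∈ range N, rightStep (π.rightSet k) (π.rightSet (k + 1)) *
        s ^ partSum (π.rightSet (k + 1)) := by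
  simp only [leftStep, rightStep, hπ.interlace_leftSet, hπ.interlace_rightSet, if_true,
    prod_mul_distrib, prod_pow_eq_pow_sum, hπ.numComponents_eq_sum h, hπ.weight_eq h, pow_add]
  ring

open Classical in
/-- The generating function of strict plane partitions in a square box. -/
lemma tsum_fits (s : ℝ≥0∞) (N : ℕ) :
    ∑' π : {π : PlanePartition // π.IsStrict},
        (if π.1.Fits N then 2 ^ numComponents π.1.part * s ^ π.1.weight else 0) =
      ∏ j ∈ range N, ∏ i ∈ range N, cayley (s ^ (1 + j + i)) := by
  let F : Finset ℕ × (ℕ → Finset ℕ) × (ℕ → Finset ℕ) → ℝ≥0∞ := fun x =>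
    s ^ partSum x.1 *
      (if x.2.1 0 = x.1 ∧ ∀ k, N ≤ k → x.2.1 k = ∅ then
        ∏ k ∈ range N, leftStep (x.2.1 k) (x.2.1 (k + 1)) * s ^ partSum (x.2.1 (k + 1)) else 0) *
      (if x.2.2 0 = x.1 ∧ ∀ k, N ≤ k → x.2.2 k = ∅ then
        ∏ k ∈ range N, rightStep (x.2.2 k) (x.2.2 (k + 1)) * s ^ partSum (x.2.2 (k + 1)) else 0)
  have hF : ∑' x, F x = ∏ j ∈ range N, ∏ i ∈ range N, cayley (s ^ (1 + j + i)) := by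
    rw [← tsum_leftSum_mul_rightSum, ENNReal.tsum_prod']
    refine tsum_congr fun S => ?_
    rw [leftSum, rightSum, chainSum_eq_tsum, chainSum_eq_tsum, ENNReal.tsum_prod', pow_one,
      mul_assoc, ← ENNReal.tsum_mul_right, ← ENNReal.tsum_mul_left]
    refine tsum_congr fun L => ?_
    rw [← ENNReal.tsum_mul_left, ← ENNReal.tsum_mul_left]
    exact tsum_congr fun R => mul_assoc _ _ _
  let e : {π : PlanePartition // π.IsStrict ∧ π.Fits N} →
      Finset ℕ × (ℕ → Finset ℕ) × (ℕ → Finset ℕ) := fun π =>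
    (π.1.leftSet 0, π.1.leftSet, π.1.rightSet)
  have he : Function.Injective e := fun π ρ h => by
    simp only [e, Prod.mk.injEq] at h
    exact Subtype.ext (π.2.1.ext_sets ρ.2.1 h.2.1 h.2.2)
  have hr : Function.support F ⊆ Set.range e := by
    rintro ⟨S, L, R⟩ hx
    have hx : F (S, L, R) ≠ 0 := hx
    simp only [F, ne_eq, mul_eq_zero, not_or, ite_eq_right_iff, Classical.not_imp, prod_eq_zero_iff,
      not_exists, not_and, mem_range] at hx
    obtain ⟨⟨-, ⟨hL0, hLN⟩, hL⟩, ⟨hR0, hRN⟩, hR⟩ := hx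
    have aux : ∀ {A : ℕ → Finset ℕ}, (∀ k, N ≤ k → A k = ∅) →
        (∀ k < N, Interlace (A k) (A (k + 1))) → ∀ k, Interlace (A k) (A (k + 1)) := by
      intro A hA hA' k
      rcases lt_or_ge k N with hk | hk
      · exact hA' k hk
      · rw [hA k hk, hA (k + 1) (by omega), interlace_empty_left]
    obtain ⟨π, h1, h2, rfl, rfl⟩ := exists_of_interlace (N := N) (hL0.trans hR0.symm)
      (aux hLN fun k hk => by by_contra h; exact (hL k hk).1 (if_neg h))
      (aux hRN fun k hk => by by_contra h; exact (hR k hk).1 (if_neg h))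
      (hLN N le_rfl) (hRN N le_rfl)
    exact ⟨⟨π, h1, h2⟩, by simp [e, hL0]⟩
  rw [← hF, ← he.tsum_eq hr]
  let i : {π : PlanePartition // π.IsStrict ∧ π.Fits N} → {π : PlanePartition // π.IsStrict} :=
    fun π => ⟨π.1, π.2.1⟩
  have hi : Function.Injective i := fun π ρ h => Subtype.ext (Subtype.mk.inj h)
  rw [← hi.tsum_eq]
  · refine tsum_congr fun π => ?_
    have hl : π.1.leftSet 0 = π.1.leftSet 0 ∧ ∀ k, N ≤ k → π.1.leftSet k = ∅ :=
      ⟨rfl, fun k hk => π.2.1.leftSet_eq_empty π.2.2 hk⟩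
    have hr : π.1.rightSet 0 = π.1.leftSet 0 ∧ ∀ k, N ≤ k → π.1.rightSet k = ∅ :=
      ⟨rfl, fun k hk => π.2.1.rightSet_eq_empty π.2.2 hk⟩
    dsimp only [F, e, i]
    rw [if_pos π.2.2, if_pos hl, if_pos hr]
    exact π.2.1.two_pow_mul_pow π.2.2 s
  · rintro ⟨π, hπ⟩ h
    have hN : π.Fits N := by
      by_contra hN
      exact h (if_neg hN)
    exact ⟨⟨π, hπ, hN⟩, rfl⟩

end PlanePartition

/-! ### The limit -/

lemma one_le_cayley (z : ℝ≥0∞) : 1 ≤ cayley z :=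
  one_le_mul le_self_add ((pow_zero z).symm.le.trans (ENNReal.le_tsum 0))

lemma cayley_ofReal {x : ℝ} (h0 : 0 ≤ x) (h1 : x < 1) :
    cayley (ENNReal.ofReal x) = ENNReal.ofReal ((1 + x) / (1 - x)) := by
  rw [cayley, ENNReal.tsum_geometric, ← ENNReal.ofReal_one, ← ENNReal.ofReal_add zero_le_one h0,
    ← ENNReal.ofReal_sub _ h0, ← ENNReal.ofReal_inv_of_pos (by linarith),
    ← ENNReal.ofReal_mul (by linarith), div_eq_mul_inv]

lemma prod_prod_add_eq (c : ℕ → ℝ≥0∞) (N : ℕ) :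
    ∏ j ∈ range N, ∏ i ∈ range N, c (1 + j + i) =
      ∏ n ∈ range (2 * N),
        c (n + 1) ^ #{p ∈ range N ×ˢ range N | p.1 + p.2 = n} := by
  rw [← prod_product', ← prod_fiberwise_of_maps_to (t := range (2 * N)) (g := fun p => p.1 + p.2)]
  · refine prod_congr rfl fun n _ => prod_eq_pow_card fun p hp => ?_
    rw [← (mem_filter.1 hp).2]
    congr 1
    ring
  · intro p hp
    simp only [mem_product, mem_range] at hp ⊢
    omega

lemma prod_prod_add_le {c : ℕ → ℝ≥0∞} (hc : ∀ n, 1 ≤ c n) (N : ℕ) :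
    ∏ j ∈ range N, ∏ i ∈ range N, c (1 + j + i) ≤ ∏ n ∈ range (2 * N), c (n + 1) ^ (n + 1) := by
  rw [prod_prod_add_eq]
  refine prod_le_prod' fun n _ => pow_le_pow_right₀ (hc _) ?_
  rw [← Finset.Nat.card_antidiagonal n]
  refine card_le_card fun p hp => ?_
  rw [HasAntidiagonal.mem_antidiagonal]
  exact (mem_filter.1 hp).2

lemma le_prod_prod_add {c : ℕ → ℝ≥0∞} (hc : ∀ n, 1 ≤ c n) (N : ℕ) :
    ∏ n ∈ range N, c (n + 1) ^ (n + 1) ≤ ∏ j ∈ range N, ∏ i ∈ range N, c (1 + j + i) := by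
  rw [prod_prod_add_eq]
  refine (prod_le_prod' fun n hn => ?_).trans (prod_le_prod_of_subset_of_one_le'
    (range_mono (by omega : N ≤ 2 * N)) fun n _ _ => one_le_pow₀ (hc _))
  refine pow_le_pow_right₀ (hc _) ?_
  rw [← Finset.Nat.card_antidiagonal n]
  refine card_le_card fun p hp => ?_
  rw [HasAntidiagonal.mem_antidiagonal] at hp
  simp only [mem_filter, mem_product, mem_range] at hn ⊢
  omega

lemma one_le_cayley_real {x : ℝ} (h0 : 0 ≤ x) (h1 : x < 1) : 1 ≤ (1 + x) / (1 - x) := by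
  rw [le_div_iff₀ (by linarith)]
  linarith

lemma log_cayley_le {x s : ℝ} (h0 : 0 ≤ x) (hxs : x ≤ s) (hs : s < 1) :
    Real.log ((1 + x) / (1 - x)) ≤ x * (2 / (1 - s)) := by
  have h1 : 0 < 1 - x := by linarith
  refine (Real.log_le_sub_one_of_pos (by positivity)).trans ?_
  have h2 : (1 + x) / (1 - x) - 1 = x * (2 / (1 - x)) := by
    field_simp
    ring
  rw [h2]
  refine mul_le_mul_of_nonneg_left ?_ h0
  exact div_le_div_of_nonneg_left zero_le_two (by linarith) (by linarith)

lemma multipliable_macmahon {s : ℝ} (hs0 : 0 ≤ s) (hs1 : s < 1) :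
    Multipliable fun n : ℕ => ((1 + s ^ (n + 1)) / (1 - s ^ (n + 1))) ^ (n + 1) := by
  have hone : ∀ n : ℕ, 1 ≤ (1 + s ^ (n + 1)) / (1 - s ^ (n + 1)) := fun n =>
    one_le_cayley_real (pow_nonneg hs0 _) (pow_lt_one₀ hs0 hs1 (Nat.succ_ne_zero n))
  refine Real.multipliable_of_summable_log
    (fun n => pow_pos (zero_lt_one.trans_le (hone n)) _) ?_
  have hgeom : Summable fun n : ℕ => (n : ℝ) ^ 1 * s ^ n :=
    summable_pow_mul_geometric_of_norm_lt_one 1 (by rwa [Real.norm_of_nonneg hs0])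
  refine Summable.of_nonneg_of_le (fun n => Real.log_nonneg (one_le_pow₀ (hone n)))
    (fun n => ?_) (((summable_nat_add_iff 1).2 hgeom).mul_right (2 / (1 - s)))
  rw [Real.log_pow, pow_one, mul_assoc]
  exact mul_le_mul_of_nonneg_left (log_cayley_le (pow_nonneg hs0 _)
    (pow_le_of_le_one hs0 hs1.le (Nat.succ_ne_zero n)) hs1) (Nat.cast_nonneg _)

lemma tsum_strict_le {B : ℝ≥0∞} (s : ℝ≥0∞)
    (h : ∀ N, ∏ j ∈ range N, ∏ i ∈ range N, cayley (s ^ (1 + j + i)) ≤ B) :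
    ∑' π : {π : PlanePartition // π.IsStrict},
      2 ^ numComponents π.1.part * s ^ π.1.weight ≤ B := by
  classical
  rw [ENNReal.tsum_eq_iSup_sum]
  refine iSup_le fun F => ?_
  choose M hM using fun π : {π : PlanePartition // π.IsStrict} => π.1.exists_fits
  refine le_trans ?_ (h (F.sup M))
  rw [← PlanePartition.tsum_fits]
  refine le_trans (sum_le_sum fun π hπ => ?_) (ENNReal.sum_le_tsum F)
  rw [if_pos (hM π _ (le_sup hπ))]

lemma le_tsum_strict (s : ℝ≥0∞) (N : ℕ) :
    ∏ j ∈ range N, ∏ i ∈ range N, cayley (s ^ (1 + j + i)) ≤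
      ∑' π : {π : PlanePartition // π.IsStrict},
        2 ^ numComponents π.1.part * s ^ π.1.weight := by
  rw [← PlanePartition.tsum_fits]
  refine ENNReal.tsum_le_tsum fun π => ?_
  split_ifs
  · exact le_rfl
  · exact zero_le

/-- **The shifted MacMahon's formula.**
`∑_{π ∈ SP} 2^{k(π)} s^{|π|} = ∏_{n=1}^{∞} [ (1 + sⁿ) / (1 - sⁿ) ]ⁿ`,
the sum being over all strict plane partitions, for real `0 ≤ s < 1`. -/
theorem shifted_macmahon (s : ℝ) (hs0 : 0 ≤ s) (hs1 : s < 1) :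
    ∑' π : {π : PlanePartition // π.IsStrict},
        (2 : ℝ) ^ numComponents π.1.part * s ^ π.1.weight =
      ∏' n : ℕ, ((1 + s ^ (n + 1)) / (1 - s ^ (n + 1))) ^ (n + 1) := by
  have hx : ∀ n : ℕ, s ^ (n + 1) < 1 := fun n => pow_lt_one₀ hs0 hs1 (Nat.succ_ne_zero n)
  have hone : ∀ n : ℕ, 1 ≤ ((1 + s ^ (n + 1)) / (1 - s ^ (n + 1))) ^ (n + 1) := fun n =>
    one_le_pow₀ (one_le_cayley_real (pow_nonneg hs0 _) (hx n))
  have hpart : ∀ N : ℕ, ∏ n ∈ range N, cayley (ENNReal.ofReal s ^ (n + 1)) ^ (n + 1) =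
      ENNReal.ofReal (∏ n ∈ range N, ((1 + s ^ (n + 1)) / (1 - s ^ (n + 1))) ^ (n + 1)) := by
    intro N
    rw [ENNReal.ofReal_prod_of_nonneg fun n _ => zero_le_one.trans (hone n)]
    refine prod_congr rfl fun n _ => ?_
    rw [← ENNReal.ofReal_pow hs0, cayley_ofReal (pow_nonneg hs0 _) (hx n), ENNReal.ofReal_pow]
    exact zero_le_one.trans (one_le_cayley_real (pow_nonneg hs0 _) (hx n))
  have hlim := (multipliable_macmahon hs0 hs1).hasProd.tendsto_prod_nat
  have hmono : Monotone fun N : ℕ =>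
      ∏ n ∈ range N, ((1 + s ^ (n + 1)) / (1 - s ^ (n + 1))) ^ (n + 1) := by
    refine monotone_nat_of_le_succ fun N => ?_
    rw [prod_range_succ]
    exact le_mul_of_one_le_right (prod_nonneg fun n _ => zero_le_one.trans (hone n)) (hone N)
  have hle := hmono.ge_of_tendsto hlim
  have htotal : ∑' π : {π : PlanePartition // π.IsStrict},
      2 ^ numComponents π.1.part * ENNReal.ofReal s ^ π.1.weight =
        ENNReal.ofReal (∏' n : ℕ, ((1 + s ^ (n + 1)) / (1 - s ^ (n + 1))) ^ (n + 1)) := by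
    refine le_antisymm (tsum_strict_le _ fun N => ?_)
      (le_of_tendsto' (ENNReal.tendsto_ofReal hlim) fun N => ?_)
    · refine (prod_prod_add_le (c := fun n => cayley (ENNReal.ofReal s ^ n))
        (fun n => one_le_cayley _) N).trans ?_
      rw [hpart]
      exact ENNReal.ofReal_le_ofReal (hle _)
    · rw [← hpart]
      exact (le_prod_prod_add (c := fun n => cayley (ENNReal.ofReal s ^ n))
        (fun n => one_le_cayley _) N).trans (le_tsum_strict _ N)
  have h0 : 0 ≤ ∏' n : ℕ, ((1 + s ^ (n + 1)) / (1 - s ^ (n + 1))) ^ (n + 1) :=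
    zero_le_one.trans (hle 0)
  rw [← ENNReal.toReal_ofReal h0, ← htotal, ENNReal.tsum_toReal_eq]
  · refine tsum_congr fun π => ?_
    rw [ENNReal.toReal_mul, ENNReal.toReal_pow, ENNReal.toReal_pow, ENNReal.toReal_ofReal hs0,
      ENNReal.toReal_ofNat]
  · exact fun π => ENNReal.mul_ne_top (ENNReal.pow_ne_top ENNReal.ofNat_ne_top)
      (ENNReal.pow_ne_top ENNReal.ofReal_ne_top)
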